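/- arXiv:2208.00359 — 4 statements merged into one kernel-verified Lean document; each statement's English description precedes it below -/
import Mathlib

section
/- Let f ∈ O_K[X] be a polynomial of degree d ≥ 2 whose leading coefficient is a unit of O_K, and let c ∈ O_K satisfy v(f'(c)) ≥ 1. Let e be the Weierstrass degree of the polynomial g(X) = f(X + c) − f(c) ∈ O_K[X]; then 2 ≤ e ≤ d. Let α ∈ K with v(α − f(c)) = 1. Then: (i) there exists a root β ∈ K̄ of f(X) − α with v(β − c) > 0; (ii) every root β ∈ K̄ of f(X) − α with v(β − c) > 0 satisfies v(β − c) = 1/e; and (iii) for every such root, e divides the ramification index e(K(β)/K), so that K(β)/K is a ramified extension. -/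
/-- `RamIdxEq v L M e` : the ramification index `e(M/L)` equals `e`, expressed via value
groups: `v(M×) = (1/e) · v(L×)`, i.e. `q ∈ v(M×) ↔ e·q ∈ v(L×)`. -/
def RamIdxEq {K F : Type*} [Field K] [Field F] [Algebra K F]
    (v : F → WithTop ℚ) (L M : IntermediateField K F) (e : ℕ) : Prop :=
  ∀ q : ℚ, (∃ x ∈ M, v x = (q : WithTop ℚ)) ↔ ∃ y ∈ L, v y = (((e : ℚ) * q : ℚ) : WithTop ℚ)

open Polynomial

namespace AddValuation

variable {F : Type*} [Field F]

theorem exists_ne_map_eq_of_sum_eq_zero (w : AddValuation F (WithTop ℚ)) {ι : Type*}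
    {s : Finset ι} {f : ι → F} (hsum : ∑ i ∈ s, f i = 0) (hne : ∃ i ∈ s, f i ≠ 0) :
    ∃ i ∈ s, ∃ j ∈ s, i ≠ j ∧ w (f i) = w (f j) ∧ f i ≠ 0 := by
  classical
  obtain ⟨k, hk, hfk⟩ := hne
  obtain ⟨i, hi, hmin⟩ := s.exists_min_image (fun i => w (f i)) ⟨k, hk⟩
  have hfi : w (f i) ≠ ⊤ := fun h =>
    hfk ((w.top_iff).1 (top_le_iff.1 (h ▸ hmin k hk)))
  by_contra! hcon
  have hlt : w (f i) < w (∑ j ∈ s.erase i, f j) := by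
    refine w.map_lt_sum hfi fun j hj => ?_
    rw [Finset.mem_erase] at hj
    refine lt_of_le_of_ne (hmin j hj.2) fun h => ?_
    exact hfi ((w.top_iff).2 (hcon i hi j hj.2 (Ne.symm hj.1) h))
  have := w.map_add_eq_of_lt_left hlt
  rw [Finset.add_sum_erase _ _ hi, hsum, w.map_zero] at this
  exact hfi this.symm

theorem map_multiset_prod_nonpos (w : AddValuation F (WithTop ℚ)) (s : Multiset F)
    (h : ∀ x ∈ s, w x ≤ 0) : w s.prod ≤ 0 := by
  induction s using Multiset.induction_on with
  | empty => simp
  | cons a s ih =>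
    rw [Multiset.prod_cons, w.map_mul]
    exact add_nonpos (h a (Multiset.mem_cons_self a s))
      (ih fun x hx => h x (Multiset.mem_cons_of_mem hx))

theorem exists_isRoot_map_pos (w : AddValuation F (WithTop ℚ)) {h : F[X]} (hs : h.Splits)
    (hlead : w h.leadingCoeff = 0) (h0 : 0 < w (h.coeff 0)) :
    ∃ γ, h.IsRoot γ ∧ 0 < w γ := by
  by_contra! hcon
  have hprod : w h.roots.prod ≤ 0 :=
    w.map_multiset_prod_nonpos _ fun x hx => hcon x (isRoot_of_mem_roots hx)
  have hsign : w ((-1) ^ h.natDegree) = 0 := by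
    rw [w.map_pow, w.map_neg, w.map_one, smul_zero]
  rw [hs.coeff_zero_eq_leadingCoeff_mul_prod_roots, w.map_mul, w.map_mul, hlead, hsign,
    zero_add, zero_add] at h0
  exact absurd hprod (not_le.2 h0)

/-- If the coefficients of `h` are integral, `h` has no constant term and Weierstrass degree `e`,
then a point of positive valuation at which `h` takes a value of valuation `1` has
valuation `1 / e`. -/
theorem map_eq_one_div_of_map_eval_eq_one (w : AddValuation F (WithTop ℚ)) {h : F[X]}
    (hint : ∀ i, 0 ≤ w (h.coeff i)) (h0 : h.coeff 0 = 0) {e : ℕ} (he : 1 ≤ e)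
    (hunit : w (h.coeff e) = 0) (hmin : ∀ i, 1 ≤ i → i < e → 1 ≤ w (h.coeff i))
    {γ : F} (hγ : w (h.eval γ) = ((1 : ℚ) : WithTop ℚ)) (hpos : 0 < w γ) :
    w γ = ((1 / (e : ℚ) : ℚ) : WithTop ℚ) := by
  have hγ0 : γ ≠ 0 := by
    rintro rfl
    rw [← coeff_zero_eq_eval_zero, h0, w.map_zero] at hγ
    exact WithTop.coe_ne_top hγ.symm
  obtain ⟨s, hs⟩ := WithTop.ne_top_iff_exists.1 ((w.ne_top_iff).2 hγ0)
  rw [← hs] at hpos ⊢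
  have hs0 : 0 < s := by exact_mod_cast hpos
  have hterm (i : ℕ) : w (h.coeff i * γ ^ i) = w (h.coeff i) + ((i * s : ℚ) : WithTop ℚ) := by
    rw [w.map_mul, w.map_pow, ← hs, ← WithTop.coe_nsmul, nsmul_eq_mul]
  have hlead : w (h.coeff e * γ ^ e) = ((e * s : ℚ) : WithTop ℚ) := by
    rw [hterm, hunit, zero_add]
  have hother (i : ℕ) (hi : i ≠ e) :
      ((min 1 (e * s) : ℚ) : WithTop ℚ) < w (h.coeff i * γ ^ i) := by
    rcases Nat.eq_zero_or_pos i with rfl | hi0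
    · rw [h0, zero_mul, w.map_zero]
      exact WithTop.coe_lt_top _
    · rw [hterm]
      have hi0' : (0 : ℚ) < i := by exact_mod_cast hi0
      rcases lt_or_gt_of_ne hi with hlt | hgt
      · refine lt_of_lt_of_le ?_ (add_le_add_left (hmin i hi0 hlt) _)
        rw [← WithTop.coe_one, ← WithTop.coe_add, WithTop.coe_lt_coe]
        exact (min_le_left _ _).trans_lt (by nlinarith)
      · refine lt_of_lt_of_le ?_ (add_le_add_left (hint i) _)
        rw [zero_add, WithTop.coe_lt_coe]
        refine (min_le_right _ _).trans_lt ?_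
        have : (e : ℚ) < i := by exact_mod_cast hgt
        nlinarith
  have hmem : e ∈ Finset.range (h.natDegree + 1) := by
    rw [Finset.mem_range, Nat.lt_succ_iff]
    refine le_natDegree_of_ne_zero fun hzero => ?_
    rw [hzero, w.map_zero] at hunit
    exact WithTop.top_ne_zero hunit
  have hrest : ((min 1 (e * s) : ℚ) : WithTop ℚ) <
      w (∑ i ∈ (Finset.range (h.natDegree + 1)).erase e, h.coeff i * γ ^ i) :=
    w.map_lt_sum WithTop.coe_ne_top fun i hi => hother i (Finset.ne_of_mem_erase hi)
  rw [eval_eq_sum_range, ← Finset.add_sum_erase _ _ hmem] at hγ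
  have he0 : (0 : ℚ) < e := by exact_mod_cast he
  have hes : (e : ℚ) * s = 1 := by
    rcases lt_trichotomy ((e : ℚ) * s) 1 with hlt | heq | hgt
    · rw [min_eq_right hlt.le, ← hlead] at hrest
      rw [w.map_add_eq_of_lt_left hrest, hlead, WithTop.coe_inj] at hγ
      exact hγ
    · exact heq
    · rw [min_eq_left hgt.le] at hrest
      have := w.map_lt_add (hlead ▸ WithTop.coe_lt_coe.2 hgt) hrest
      rw [hγ] at this
      exact absurd this (lt_irrefl _)
  rw [WithTop.coe_inj, eq_div_iff he0.ne', mul_comm, hes]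

section Algebra

variable {K : Type*} [Field K] [Algebra K F]

theorem map_coeff_taylor_nonneg (w : AddValuation F (WithTop ℚ)) {f : K[X]}
    (hf : ∀ i, 0 ≤ w (algebraMap K F (f.coeff i))) {c : K} (hc : 0 ≤ w (algebraMap K F c))
    (n : ℕ) : 0 ≤ w (algebraMap K F ((taylor c f).coeff n)) := by
  have hnat (m : ℕ) : 0 ≤ w (m : F) := by
    induction m with
    | zero => simp
    | succ m ih => rw [Nat.cast_succ]; exact w.map_le_add ih (by simp)
  rw [taylor_coeff, eval_eq_sum_range, map_sum]
  refine w.map_le_sum fun i _ => ?_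
  rw [hasseDeriv_coeff, RingHom.map_mul, RingHom.map_mul, map_natCast, RingHom.map_pow,
    w.map_mul, w.map_mul, w.map_pow]
  exact add_nonneg (add_nonneg (hnat _) (hf _)) (nsmul_nonneg hc i)

theorem exists_natCast_mul_eq_intCast (w : AddValuation F (WithTop ℚ))
    (hint : ∀ x : K, x ≠ 0 → ∃ n : ℤ, w (algebraMap K F x) = ((n : ℚ) : WithTop ℚ))
    {x : F} (hx : IsIntegral K x) {q : ℚ}
    (hq : w x = (q : WithTop ℚ)) :
    ∃ m : ℕ, 0 < m ∧ m ≤ (minpoly K x).natDegree ∧ ∃ n : ℤ, (m : ℚ) * q = n := by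
  have hx0 : x ≠ 0 := by
    rintro rfl
    rw [w.map_zero] at hq
    exact WithTop.coe_ne_top hq.symm
  have hsum := minpoly.aeval K x
  rw [aeval_eq_sum_range] at hsum
  obtain ⟨i, hi, j, hj, hij, heq, hne⟩ := w.exists_ne_map_eq_of_sum_eq_zero hsum
    ⟨(minpoly K x).natDegree, by simp, by
      rw [coeff_natDegree, (minpoly.monic hx).leadingCoeff, one_smul]
      exact pow_ne_zero _ hx0⟩
  have hterm (k : ℕ) (hk : (minpoly K x).coeff k ≠ 0) :
      ∃ n : ℤ, w ((minpoly K x).coeff k • x ^ k) = ((n + k * q : ℚ) : WithTop ℚ) := by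
    obtain ⟨n, hn⟩ := hint _ hk
    refine ⟨n, ?_⟩
    rw [Algebra.smul_def, w.map_mul, w.map_pow, hn, hq, ← WithTop.coe_nsmul, nsmul_eq_mul,
      ← WithTop.coe_add]
  have hci : (minpoly K x).coeff i ≠ 0 := fun h => hne (by rw [h, zero_smul])
  have hcj : (minpoly K x).coeff j ≠ 0 := fun h => by
    rw [h, zero_smul, w.map_zero] at heq
    exact hne ((w.top_iff).1 heq)
  obtain ⟨a, ha⟩ := hterm i hci
  obtain ⟨b, hb⟩ := hterm j hcj
  rw [ha, hb, WithTop.coe_inj] at heq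
  rw [Finset.mem_range] at hi hj
  rcases lt_or_gt_of_ne hij with h | h
  · refine ⟨j - i, by omega, by omega, a - b, ?_⟩
    rw [Nat.cast_sub h.le]
    push_cast
    linarith
  · refine ⟨i - j, by omega, by omega, b - a, ?_⟩
    rw [Nat.cast_sub h.le]
    push_cast
    linarith

theorem one_le_map_algebraMap_of_pos (w : AddValuation F (WithTop ℚ))
    (hint : ∀ x : K, x ≠ 0 → ∃ n : ℤ, w (algebraMap K F x) = ((n : ℚ) : WithTop ℚ))
    {x : K} (hx : 0 < w (algebraMap K F x)) :
    1 ≤ w (algebraMap K F x) := by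
  rcases eq_or_ne x 0 with rfl | hx0
  · simp
  · obtain ⟨n, hn⟩ := hint x hx0
    rw [hn] at hx ⊢
    have : (0 : ℚ) < n := by exact_mod_cast hx
    have : 0 < n := by exact_mod_cast this
    have : (1 : ℚ) ≤ n := by exact_mod_cast this
    exact_mod_cast this

end Algebra

end AddValuation

/-- A subgroup of `ℚ` containing `ℤ` with bounded denominators is `(1 / E) ℤ` for some `E`. -/
theorem AddSubgroup.exists_mem_iff_natCast_mul_eq_intCast (H : AddSubgroup ℚ) (h1 : (1 : ℚ) ∈ H)
    {N : ℕ} (hN : 0 < N) (hH : ∀ q ∈ H, ∃ k : ℤ, (N : ℚ) * q = k) :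
    ∃ E : ℕ, 0 < E ∧ ∀ q : ℚ, q ∈ H ↔ ∃ k : ℤ, (E : ℚ) * q = k := by
  have hN0 : (N : ℚ) ≠ 0 := by exact_mod_cast hN.ne'
  let φ : ℤ →+ ℚ := (AddMonoidHom.mulRight ((N : ℚ)⁻¹)).comp (Int.castAddHom ℚ)
  have hφ (k : ℤ) : φ k = k * (N : ℚ)⁻¹ := rfl
  obtain ⟨a, ha⟩ := Int.subgroup_cyclic (H.comap φ)
  have hmem (k : ℤ) : (k : ℚ) * (N : ℚ)⁻¹ ∈ H ↔ a ∣ k := by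
    rw [← hφ, ← AddSubgroup.mem_comap, ha, ← AddSubgroup.zmultiples_eq_closure,
      Int.mem_zmultiples_iff]
  have haN : a ∣ (N : ℤ) := (hmem N).1 (by simpa [hN0] using h1)
  obtain ⟨E, hE⟩ := Int.natAbs_dvd.2 haN
  have hEpos : 0 < E := by
    have : (0 : ℤ) < (a.natAbs : ℤ) * E := by rw [← hE]; exact_mod_cast hN
    exact pos_of_mul_pos_right this (by positivity)
  lift E to ℕ using hEpos.le
  have hEq : (N : ℚ) = (a.natAbs : ℚ) * E := by exact_mod_cast hE
  have ha0 : (a.natAbs : ℚ) ≠ 0 := fun h => hN0 (by rw [hEq, h, zero_mul])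
  have hE0 : (E : ℚ) ≠ 0 := fun h => hN0 (by rw [hEq, h, mul_zero])
  refine ⟨E, by exact_mod_cast hEpos, fun q => ⟨fun hq => ?_, ?_⟩⟩
  · obtain ⟨k, hk⟩ := hH q hq
    have hqk : q = k * (N : ℚ)⁻¹ := by rw [← hk]; field_simp
    rw [hqk, hmem, ← Int.natAbs_dvd] at hq
    obtain ⟨m, rfl⟩ := hq
    refine ⟨m, ?_⟩
    rw [hqk, hEq, Int.cast_mul, Int.cast_natCast]
    field_simp
  · rintro ⟨k, hk⟩
    have hqk : q = ((a.natAbs * k : ℤ) : ℚ) * (N : ℚ)⁻¹ := by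
      rw [hEq, Int.cast_mul, Int.cast_natCast, ← hk]
      field_simp
    rw [hqk, hmem, ← Int.natAbs_dvd]
    exact dvd_mul_right _ _

theorem AddValuation.exists_ramIdxEq_bot {K F : Type*} [Field K] [Field F] [Algebra K F]
    (w : AddValuation F (WithTop ℚ))
    (hint : ∀ x : K, x ≠ 0 → ∃ n : ℤ, w (algebraMap K F x) = ((n : ℚ) : WithTop ℚ))
    (hsurj : ∀ n : ℤ, ∃ x : K, w (algebraMap K F x) = ((n : ℚ) : WithTop ℚ))
    (M : IntermediateField K F) [FiniteDimensional K M] :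
    ∃ E : ℕ, 0 < E ∧ RamIdxEq w ⊥ M E ∧
      ∀ q : ℚ, (∃ x ∈ M, w x = (q : WithTop ℚ)) ↔ ∃ k : ℤ, (E : ℚ) * q = k := by
  let H : AddSubgroup ℚ :=
    { carrier := {q | ∃ x ∈ M, w x = (q : WithTop ℚ)}
      zero_mem' := ⟨1, M.one_mem, by simp⟩
      add_mem' := by
        rintro a b ⟨x, hx, hxa⟩ ⟨y, hy, hyb⟩
        exact ⟨x * y, M.mul_mem hx hy, by rw [w.map_mul, hxa, hyb, WithTop.coe_add]⟩
      neg_mem' := by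
        rintro a ⟨x, hx, hxa⟩
        refine ⟨x⁻¹, M.inv_mem hx, ?_⟩
        rw [w.map_inv, hxa]
        rfl }
  have h1 : (1 : ℚ) ∈ H := by
    obtain ⟨x, hx⟩ := hsurj 1
    exact ⟨_, M.algebraMap_mem x, by simpa using hx⟩
  obtain ⟨E, hE, hiff⟩ := H.exists_mem_iff_natCast_mul_eq_intCast h1
    (Nat.factorial_pos (Module.finrank K M)) (by
      rintro q ⟨x, hx, hq⟩
      have hxint : IsIntegral K (⟨x, hx⟩ : M) := IsIntegral.of_finite K _
      have hminpoly : minpoly K x = minpoly K (⟨x, hx⟩ : M) := (IntermediateField.minpoly_eq (⟨x, hx⟩ : M)).symm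
      obtain ⟨m, hm0, hm, n, hn⟩ := w.exists_natCast_mul_eq_intCast hint
        (IntermediateField.isIntegral_iff.1 hxint) hq
      have hle : m ≤ Module.finrank K M :=
        hm.trans (hminpoly ▸ minpoly.natDegree_le (⟨x, hx⟩ : M))
      obtain ⟨t, ht⟩ := Nat.dvd_factorial hm0 hle
      refine ⟨t * n, ?_⟩
      rw [ht]
      push_cast
      rw [← hn]
      ring)
  refine ⟨E, hE, fun q => (hiff q).trans ?_, hiff⟩
  constructor
  · rintro ⟨k, hk⟩
    obtain ⟨x, hx⟩ := hsurj k
    exact ⟨_, (⊥ : IntermediateField K F).algebraMap_mem x, by rw [hx, hk]⟩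
  · rintro ⟨y, hy, hyq⟩
    obtain ⟨x, rfl⟩ := IntermediateField.mem_bot.1 hy
    have hx0 : x ≠ 0 := by
      rintro rfl
      rw [RingHom.map_zero, w.map_zero] at hyq
      exact WithTop.coe_ne_top hyq.symm
    obtain ⟨n, hn⟩ := hint x hx0
    exact ⟨n, by rw [hn, WithTop.coe_inj] at hyq; exact hyq.symm⟩

/-- Let `f ∈ O_K[X]` of degree `d ≥ 2` with unit leading coefficient,
`c ∈ O_K` with `v (f' c) ≥ 1`, and let `e` be the Weierstrass degree of
`g X = f (X + c) - f c`.  Let `α ∈ K` with `v (α - f c) = 1`.  Then `2 ≤ e ≤ d`;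
there exists a root `β` of `f X - α` with `v (β - c) > 0`; every such root satisfies
`v (β - c) = 1 / e`; and for every such root `e` divides `e(K(β)/K)`, so `K(β)/K`
is ramified. -/
theorem root_near_critical_point_ramifies
    {p : ℕ} [Fact (Nat.Prime p)]
    {K : Type*} [Field K] [Algebra ℚ_[p] K] [FiniteDimensional ℚ_[p] K]
    -- `v` is the valuation on `K̄ = AlgebraicClosure K`, normalized so that `v(K×) = ℤ`:
    (v : AlgebraicClosure K → WithTop ℚ)
    (hv_top : ∀ x, v x = ⊤ ↔ x = 0)
    (hv_mul : ∀ x y, v (x * y) = v x + v y)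
    (hv_add : ∀ x y, min (v x) (v y) ≤ v (x + y))
    (hv_int : ∀ x : K, x ≠ 0 →
      ∃ n : ℤ, v (algebraMap K (AlgebraicClosure K) x) = ((n : ℚ) : WithTop ℚ))
    (hv_surj : ∀ n : ℤ, ∃ x : K,
      v (algebraMap K (AlgebraicClosure K) x) = ((n : ℚ) : WithTop ℚ))
    -- `f ∈ O_K[X]`, of degree `d ≥ 2`, with unit leading coefficient:
    (f : Polynomial K) (d : ℕ) (hd : 2 ≤ d) (hdeg : f.natDegree = d)
    (hf_int : ∀ i, 0 ≤ v (algebraMap K (AlgebraicClosure K) (f.coeff i)))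
    (hf_lead : v (algebraMap K (AlgebraicClosure K) f.leadingCoeff) = 0)
    -- `c ∈ O_K` with `v (f' c) ≥ 1`:
    (c : K) (hc : 0 ≤ v (algebraMap K (AlgebraicClosure K) c))
    (hfc : 1 ≤ v (algebraMap K (AlgebraicClosure K)
      (Polynomial.eval c (Polynomial.derivative f))))
    -- `e` is the Weierstrass degree of `g X = f (X + c) - f c`:
    (e : ℕ) (he1 : 1 ≤ e)
    (he_unit : v (algebraMap K (AlgebraicClosure K)
      ((f.comp (Polynomial.X + Polynomial.C c) - Polynomial.C (f.eval c)).coeff e)) = 0)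
    (he_min : ∀ i, 1 ≤ i → i < e → 0 < v (algebraMap K (AlgebraicClosure K)
      ((f.comp (Polynomial.X + Polynomial.C c) - Polynomial.C (f.eval c)).coeff i)))
    -- `α ∈ K` with `v (α - f c) = 1`:
    (α : K) (hα : v (algebraMap K (AlgebraicClosure K) (α - f.eval c)) = ((1 : ℚ) : WithTop ℚ)) :
    (2 ≤ e ∧ e ≤ d) ∧
    (∃ β : AlgebraicClosure K,
      Polynomial.aeval β f = algebraMap K (AlgebraicClosure K) α ∧
      0 < v (β - algebraMap K (AlgebraicClosure K) c)) ∧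
    (∀ β : AlgebraicClosure K,
      Polynomial.aeval β f = algebraMap K (AlgebraicClosure K) α →
      0 < v (β - algebraMap K (AlgebraicClosure K) c) →
      v (β - algebraMap K (AlgebraicClosure K) c) = ((1 / (e : ℚ) : ℚ) : WithTop ℚ) ∧
      ∃ E : ℕ, RamIdxEq v ⊥ (IntermediateField.adjoin K {β}) E ∧ e ∣ E ∧ 1 < E) := by
  have hv1 : v 1 = 0 := by
    have hne : v 1 ≠ ⊤ := fun h => one_ne_zero ((hv_top 1).1 h)
    have h := hv_mul 1 1
    rw [mul_one] at h
    obtain ⟨q, hq⟩ := WithTop.ne_top_iff_exists.1 hne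
    rw [← hq, ← WithTop.coe_add, WithTop.coe_inj] at h
    rw [← hq, show q = 0 by linarith, WithTop.coe_zero]
  obtain ⟨w, rfl⟩ : ∃ w : AddValuation (AlgebraicClosure K) (WithTop ℚ), v = w :=
    ⟨AddValuation.of v ((hv_top 0).2 rfl) hv1 hv_add hv_mul, rfl⟩
  set ι := algebraMap K (AlgebraicClosure K) with hι
  set g : K[X] := f.comp (X + C c) - C (f.eval c) with hg
  have hg_taylor : g = taylor c f - C (f.eval c) := by rw [hg, taylor_apply]
  have hg_zero : g.coeff 0 = 0 := by
    rw [hg_taylor, coeff_sub, taylor_coeff_zero, coeff_C_zero, sub_self]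
  have hg_coeff (i : ℕ) (hi : i ≠ 0) : g.coeff i = (taylor c f).coeff i := by
    rw [hg_taylor, coeff_sub, coeff_C_of_ne_zero hi, sub_zero]
  have hg_int (i : ℕ) : 0 ≤ w (ι (g.coeff i)) := by
    rcases eq_or_ne i 0 with rfl | hi
    · simp [hg_zero]
    · rw [hg_coeff i hi]
      exact w.map_coeff_taylor_nonneg hf_int hc i
  have he2 : 2 ≤ e := by
    by_contra hlt
    obtain rfl : e = 1 := by omega
    rw [hg_coeff 1 one_ne_zero, taylor_coeff_one] at he_unit
    rw [he_unit] at hfc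
    exact absurd hfc (by norm_num)
  have hed : e ≤ d := by
    rw [← hdeg, ← natDegree_taylor f c]
    refine le_natDegree_of_ne_zero fun h => ?_
    rw [hg_coeff e (by omega), h, map_zero, w.map_zero] at he_unit
    exact WithTop.top_ne_zero he_unit
  refine ⟨⟨he2, hed⟩, ?_, ?_⟩
  · have hlead : (taylor c f - C α).leadingCoeff = f.leadingCoeff := by
      rw [leadingCoeff_sub_of_degree_lt, leadingCoeff_taylor]
      rw [degree_taylor]
      refine degree_C_le.trans_lt (natDegree_pos_iff_degree_pos.1 ?_)
      omega
    obtain ⟨γ, hroot, hpos⟩ := w.exists_isRoot_map_pos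
      (h := (taylor c f - C α).map ι) (IsAlgClosed.splits _)
      (by rw [leadingCoeff_map, hlead, hf_lead])
      (by
        rw [coeff_map, coeff_sub, taylor_coeff_zero, coeff_C_zero, ← neg_sub, map_neg, w.map_neg,
          hα]
        exact_mod_cast zero_lt_one (α := ℚ))
    refine ⟨γ + ι c, ?_, by rwa [add_sub_cancel_right]⟩
    rw [IsRoot.def, eval_map, Polynomial.eval₂_sub, eval₂_C, sub_eq_zero, taylor_apply,
      eval₂_comp, eval₂_add, eval₂_X, eval₂_C] at hroot
    rw [aeval_def, hroot]
  · intro β hβ hpos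
    have hval : w (β - ι c) = ((1 / (e : ℚ) : ℚ) : WithTop ℚ) := by
      refine w.map_eq_one_div_of_map_eval_eq_one (h := g.map ι) (fun i => ?_) ?_ he1 ?_
        (fun i hi hie => ?_) ?_ hpos
      · rw [coeff_map]
        exact hg_int i
      · rw [coeff_map, hg_zero, map_zero]
      · rw [coeff_map, he_unit]
      · rw [coeff_map]
        exact w.one_le_map_algebraMap_of_pos hv_int (he_min i hi hie)
      · rw [eval_map, hg, eval₂_sub, eval₂_C, eval₂_comp, eval₂_add, eval₂_X, eval₂_C,
          sub_add_cancel, ← aeval_def, hβ, ← map_sub, hα]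
    refine ⟨hval, ?_⟩
    have hfin : FiniteDimensional K (IntermediateField.adjoin K {β}) :=
      IntermediateField.adjoin.finiteDimensional (Algebra.IsIntegral.isIntegral β)
    obtain ⟨E, hE, hram, hiff⟩ :=
      w.exists_ramIdxEq_bot hv_int hv_surj (IntermediateField.adjoin K {β})
    obtain ⟨k, hk⟩ := (hiff (1 / e)).1 ⟨β - ι c, sub_mem
      (IntermediateField.mem_adjoin_simple_self K β) (IntermediateField.algebraMap_mem _ c), hval⟩
    have he0 : (e : ℚ) ≠ 0 := by exact_mod_cast (by omega : e ≠ 0)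
    have hdvd : e ∣ E := by
      rw [mul_one_div, div_eq_iff he0] at hk
      refine Int.natCast_dvd_natCast.1 ⟨k, ?_⟩
      rw [mul_comm]
      exact_mod_cast hk
    exact ⟨E, hram, hdvd, lt_of_lt_of_le (by omega) (Nat.le_of_dvd hE hdvd)⟩
end

section
/- Let k be a field with algebraic closure k̄, and let f ∈ k[X] be a polynomial whose formal derivative f' is nonzero. Let (α_n)_{n≥0} be a sequence in k̄ with f(α_{n+1}) = α_n for all n ≥ 0. If f'(α_n) = 0 for infinitely many n, then: there exists c ∈ k̄ with f'(c) = 0 and an integer m ≥ 1 with f^{∘m}(c) = c; the sequence (α_n)_{n≥0} is periodic; and every α_n lies in the forward orbit {f^{∘j}(c) : j ≥ 0} of c. -/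
/-- Along a backward orbit, iterating the map moves the index down. -/
theorem iterate_backward_orbit {X : Type*} {g : X → X} {α : ℕ → X}
    (h : ∀ n, g (α (n + 1)) = α n) (n j : ℕ) : g^[j] (α (n + j)) = α n := by
  induction j with
  | zero => rfl
  | succ j ih => rw [Function.iterate_succ_apply, ← Nat.add_assoc, h, ih]

/-- A sequence that meets a finite set infinitely often visits some point of that set
infinitely often. -/
theorem exists_mem_infinite_visits {X : Type*} {α : ℕ → X} {s : Set X} (hs : s.Finite)
    (h : {n | α n ∈ s}.Infinite) : ∃ c ∈ s, {n | α n = c}.Infinite := by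
  by_contra! hc
  refine h ((hs.biUnion hc).subset fun n hn => ?_)
  exact Set.mem_biUnion (show α n ∈ s from hn) rfl

/-- Let `k` be a field with algebraic closure `k̄`, `f ∈ k[X]` with
nonzero formal derivative, and `(α n)` a sequence in `k̄` with `f (α (n+1)) = α n`.
If `f' (α n) = 0` for infinitely many `n`, then there is a critical point `c ∈ k̄` of `f`
which is periodic under `f`, the sequence `(α n)` is periodic, and every `α n` lies in the
forward orbit of `c`. -/
theorem branch_through_critical_points_is_periodic
    {k : Type*} [Field k]
    (f : Polynomial k) (hf' : Polynomial.derivative f ≠ 0)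
    (α : ℕ → AlgebraicClosure k)
    (hbranch : ∀ n, Polynomial.aeval (α (n + 1)) f = α n)
    (hcrit : {n : ℕ | Polynomial.aeval (α n) (Polynomial.derivative f) = 0}.Infinite) :
    ∃ c : AlgebraicClosure k,
      Polynomial.aeval c (Polynomial.derivative f) = 0 ∧
      (∃ m : ℕ, 1 ≤ m ∧ (fun x => Polynomial.aeval x f)^[m] c = c) ∧
      (∃ T : ℕ, 1 ≤ T ∧ ∀ n, α (n + T) = α n) ∧
      (∀ n, ∃ j : ℕ, α n = (fun x => Polynomial.aeval x f)^[j] c) := by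
  have hfin : {x : AlgebraicClosure k |
      Polynomial.aeval x (Polynomial.derivative f) = 0}.Finite := by
    refine (Polynomial.rootSet_finite (Polynomial.derivative f) (AlgebraicClosure k)).subset
      fun x hx => ?_
    exact Polynomial.mem_rootSet.mpr ⟨hf', hx⟩
  obtain ⟨c, hc, hvisits⟩ := exists_mem_infinite_visits hfin hcrit
  have hiter := iterate_backward_orbit (g := fun x => Polynomial.aeval x f) hbranch
  have horbit : ∀ n, ∃ j, α (n + j) = c := fun n => by
    obtain ⟨N, hN, hlt⟩ := hvisits.exists_gt n
    exact ⟨N - n, by rwa [Nat.add_sub_cancel' hlt.le]⟩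
  obtain ⟨a, ha⟩ := hvisits.nonempty
  obtain ⟨b, hb, hab⟩ := hvisits.exists_gt a
  obtain ⟨m, rfl⟩ := Nat.exists_eq_add_of_lt hab
  have hper : (fun x => Polynomial.aeval x f)^[m + 1] c = c := by
    have := hiter a (m + 1)
    rwa [← Nat.add_assoc, show α (a + m + 1) = c from hb, show α a = c from ha] at this
  refine ⟨c, hc, ⟨m + 1, by omega, hper⟩, ⟨m + 1, by omega, fun n => ?_⟩, fun n => ?_⟩
  · obtain ⟨j, hj⟩ := horbit (n + (m + 1))
    have h₁ := hiter (n + (m + 1)) j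
    have h₂ := hiter n (j + (m + 1))
    rw [hj] at h₁
    rw [show n + (j + (m + 1)) = n + (m + 1) + j by omega, hj, Function.iterate_add_apply,
      hper] at h₂
    exact h₁.symm.trans h₂
  · obtain ⟨j, hj⟩ := horbit n
    exact ⟨j, by rw [← hj, hiter]⟩
end

section
/- Let k be a field of characteristic p > 0 and φ : k → k the Frobenius endomorphism x ↦ x^p (which is injective). Let h ≥ 1 and let Q ∈ k[X] be a polynomial all of whose coefficients are fixed by φ^h, and set f(X) = Q(X^{p^h}) ∈ k[X]. Then a sequence (α_n)_{n≥0} in k satisfies f(α_{n+1}) = α_n for all n ≥ 0 if and only if the sequence β_n := φ^{hn}(α_n) = α_n^{p^{hn}} satisfies Q(β_{n+1}) = β_n for all n ≥ 0. -/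
/-- A polynomial whose coefficients are fixed by the `m`-th power of Frobenius commutes with every
iterate of that power. -/
theorem Polynomial.eval_pow_of_coeff_pow_eq {p : ℕ} [Fact (Nat.Prime p)] {R : Type*} [CommRing R]
    [CharP R p] {m : ℕ} {Q : Polynomial R} (hQ : ∀ i, Q.coeff i ^ p ^ m = Q.coeff i)
    (n : ℕ) (x : R) : Q.eval (x ^ p ^ (m * n)) = Q.eval x ^ p ^ (m * n) := by
  have hmap : Q.map (iterateFrobenius R p m) = Q := by
    ext i
    rw [Polynomial.coeff_map, iterateFrobenius_def, hQ]
  have hstep (y : R) : Q.eval (y ^ p ^ m) = Q.eval y ^ p ^ m := by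
    simpa only [← Polynomial.eval_map, hmap, iterateFrobenius_def] using
      Polynomial.eval₂_at_apply (p := Q) (iterateFrobenius R p m) y
  induction n with
  | zero => simp
  | succ n ih => rw [Nat.mul_succ, pow_add p, pow_mul x, hstep, ih, ← pow_mul]

/-- Let `k` have characteristic `p > 0`, `h ≥ 1`, and `Q ∈ k[X]` with all
coefficients fixed by the `h`-th power of Frobenius.  Set `f X = Q (X ^ p ^ h)`.  Then
`(α n)` satisfies `f (α (n+1)) = α n` for all `n` if and only if the untwisted sequence
`β n = α n ^ p ^ (h * n)` satisfies `Q (β (n+1)) = β n` for all `n`. -/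
theorem branch_untwisting_frobenius
    {p : ℕ} [Fact (Nat.Prime p)] {k : Type*} [Field k] [CharP k p]
    (h : ℕ) (hh : 1 ≤ h)
    (Q : Polynomial k)
    (hQfix : ∀ i, (Q.coeff i) ^ (p ^ h) = Q.coeff i)
    (α : ℕ → k) :
    (∀ n, (Q.comp (Polynomial.X ^ (p ^ h))).eval (α (n + 1)) = α n) ↔
    (∀ n, Q.eval ((α (n + 1)) ^ (p ^ (h * (n + 1)))) = (α n) ^ (p ^ (h * n))) := by
  refine forall_congr' fun n => ?_
  have hpow : α (n + 1) ^ p ^ (h * (n + 1)) = (α (n + 1) ^ p ^ h) ^ p ^ (h * n) := by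
    rw [← pow_mul, ← pow_add, Nat.mul_succ, Nat.add_comm h]
  rw [hpow, Polynomial.eval_pow_of_coeff_pow_eq hQfix, Polynomial.eval_comp, Polynomial.eval_pow,
    Polynomial.eval_X]
  exact (iterateFrobenius_inj k p (h * n)).eq_iff.symm
end

section
/- Let F̄_p be an algebraic closure of the field with p elements and φ its Frobenius map x ↦ x^p. Let h ≥ 1 and let Q ∈ F̄_p[X] be a polynomial with nonzero formal derivative Q' ≠ 0, all of whose coefficients are fixed by φ^h. Set f(X) = Q(X^{p^h}). Let (α_n)_{n≥0} be a sequence in F̄_p with f(α_{n+1}) = α_n for all n ≥ 0. If Q'(φ^{h(n+1)}(α_{n+1})) = 0 for infinitely many n, then the sequence (α_n)_{n≥0} is periodic. -/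
/-- A backward orbit of `g` that meets a finite set infinitely often is periodic. -/
theorem exists_periodic_of_backward_orbit {X : Type*} {g : X → X} {β : ℕ → X}
    (hβ : ∀ n, g (β (n + 1)) = β n) {S : Set X} (hS : S.Finite)
    (hinf : {n | β n ∈ S}.Infinite) :
    ∃ k : ℕ, 1 ≤ k ∧ Function.Periodic β k := by
  have iter : ∀ j n, g^[j] (β (n + j)) = β n := by
    intro j
    induction j with
    | zero => intro n; rfl
    | succ j ih =>
      intro n
      rw [Function.iterate_succ_apply, ← add_assoc, hβ, ih]
  obtain ⟨c, hc⟩ : ∃ c, {n | β n = c}.Infinite := by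
    by_contra! hfin
    refine hinf ((hS.biUnion fun c _ => hfin c).subset fun n hn => ?_)
    exact Set.mem_biUnion hn rfl
  obtain ⟨m, hm⟩ := hc.nonempty
  obtain ⟨n, hn, hmn⟩ := hc.exists_gt m
  obtain ⟨k, rfl⟩ := Nat.exists_eq_add_of_lt hmn
  refine ⟨k + 1, by omega, fun i => ?_⟩
  have hcyc : g^[k + 1] c = c := by
    have := iter (k + 1) m
    rwa [← add_assoc, hn, hm] at this
  obtain ⟨l, hl, hil⟩ := hc.exists_gt (i + (k + 1))
  obtain ⟨j, rfl⟩ := Nat.exists_eq_add_of_le hil.le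
  rw [← iter j (i + (k + 1)), hl, ← iter ((k + 1) + j) i, ← add_assoc, hl, add_comm (k + 1) j,
    Function.iterate_add_apply, hcyc]

/-- Every element algebraic over `𝔽_p` is fixed by a positive power of Frobenius. -/
theorem exists_pow_pow_eq_self_of_isAlgebraic {p : ℕ} [Fact (Nat.Prime p)] {K : Type*} [Field K]
    [Algebra (ZMod p) K] {x : K} (hx : IsAlgebraic (ZMod p) x) :
    ∃ N : ℕ, 1 ≤ N ∧ x ^ p ^ N = x := by
  have : FiniteDimensional (ZMod p) (IntermediateField.adjoin (ZMod p) {x}) :=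
    IntermediateField.adjoin.finiteDimensional hx.isIntegral
  have : Finite (IntermediateField.adjoin (ZMod p) {x}) := Module.finite_of_finite (ZMod p)
  have := Fintype.ofFinite (IntermediateField.adjoin (ZMod p) {x})
  refine ⟨Module.finrank (ZMod p) (IntermediateField.adjoin (ZMod p) {x}),
    Module.finrank_pos, ?_⟩
  have hpow := FiniteField.pow_card (IntermediateField.AdjoinSimple.gen (ZMod p) x)
  rw [Module.card_eq_pow_finrank (K := ZMod p), ZMod.card] at hpow
  simpa using congrArg Subtype.val hpow

/-- Evaluation of a polynomial whose coefficients are fixed by `φ ^ h` commutes with `φ ^ h`. -/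
theorem eval_pow_pow_of_coeff_fixed {p : ℕ} {K : Type*} [Field K] [ExpChar K p] {h : ℕ}
    {Q : Polynomial K} (hQ : ∀ i, Q.coeff i ^ p ^ h = Q.coeff i) (x : K) :
    Q.eval x ^ p ^ h = Q.eval (x ^ p ^ h) := by
  have hmap : Q.map (iterateFrobenius K p h) = Q := by
    ext i
    rw [Polynomial.coeff_map, iterateFrobenius_def, hQ]
  have := Polynomial.eval_map_apply (f := iterateFrobenius K p h) (p := Q) x
  rw [hmap] at this
  simpa only [iterateFrobenius_def] using this.symm

/-- Let `F̄_p` be an algebraic closure of `𝔽_p` with Frobenius `φ`,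
`h ≥ 1`, and `Q ∈ F̄_p[X]` with `Q' ≠ 0` and all coefficients fixed by `φ ^ h`.
Set `f X = Q (X ^ p ^ h)` and let `(α n)` satisfy `f (α (n+1)) = α n`.  If
`Q' (φ ^ (h * (n+1)) (α (n+1))) = 0` for infinitely many `n`, then `(α n)` is periodic. -/
theorem branch_over_Fpbar_through_critical_points_is_periodic
    {p : ℕ} [Fact (Nat.Prime p)]
    (h : ℕ) (hh : 1 ≤ h)
    (Q : Polynomial (AlgebraicClosure (ZMod p)))
    (hQ' : Polynomial.derivative Q ≠ 0)
    (hQfix : ∀ i, (Q.coeff i) ^ (p ^ h) = Q.coeff i)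
    (α : ℕ → AlgebraicClosure (ZMod p))
    (hbranch : ∀ n, (Q.comp (Polynomial.X ^ (p ^ h))).eval (α (n + 1)) = α n)
    (hcrit : {n : ℕ |
      (Polynomial.derivative Q).eval ((α (n + 1)) ^ (p ^ (h * (n + 1)))) = 0}.Infinite) :
    ∃ T : ℕ, 1 ≤ T ∧ ∀ n, α (n + T) = α n := by
  have := expChar_of_injective_algebraMap
    (algebraMap (ZMod p) (AlgebraicClosure (ZMod p))).injective p
  have fix_mul : ∀ {a : ℕ} {x : AlgebraicClosure (ZMod p)}, x ^ p ^ a = x →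
      ∀ b, x ^ p ^ (a * b) = x := by
    intro a x hx b
    induction b with
    | zero => simp
    | succ b ih => rw [Nat.mul_succ, pow_add, pow_mul, ih, hx]
  have eval_comm : ∀ n x, Q.eval x ^ p ^ (h * n) = Q.eval (x ^ p ^ (h * n)) := fun n =>
    eval_pow_pow_of_coeff_fixed fun i => fix_mul (hQfix i) n
  set β : ℕ → AlgebraicClosure (ZMod p) := fun n => α n ^ p ^ (h * n) with hβdef
  have hβ : ∀ n, Q.eval (β (n + 1)) = β n := by
    intro n
    simp only [hβdef, ← hbranch n, Polynomial.eval_comp, Polynomial.eval_pow, Polynomial.eval_X]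
    rw [eval_comm, ← pow_mul, ← pow_add, Nat.mul_succ, add_comm h]
  obtain ⟨k, hk, hper⟩ : ∃ k : ℕ, 1 ≤ k ∧ Function.Periodic β k := by
    refine exists_periodic_of_backward_orbit (g := fun x => Q.eval x) hβ
      (Polynomial.finite_setOfPred_isRoot hQ') ?_
    refine (hcrit.image (add_left_injective 1).injOn).mono ?_
    rintro _ ⟨n, hn, rfl⟩
    exact hn
  obtain ⟨N, hN, hfix⟩ := exists_pow_pow_eq_self_of_isAlgebraic
    (Algebra.IsAlgebraic.isAlgebraic (R := ZMod p) (β 0))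
  have fix_back : ∀ j n, β (n + j) ^ p ^ (h * N) = β (n + j) → β n ^ p ^ (h * N) = β n := by
    intro j
    induction j with
    | zero => exact fun _ hn => hn
    | succ j ih =>
      intro n hn
      refine ih n ?_
      rw [← hβ, eval_comm]
      exact congrArg (Q.eval ·) hn
  have β_fix : ∀ n, β n ^ p ^ (h * N) = β n := by
    intro n
    obtain ⟨j, hj⟩ := Nat.exists_eq_add_of_le (Nat.le_mul_of_pos_right n hk)
    refine fix_back j n ?_
    have h0 : β (n * k) = β 0 := by simpa using hper.nat_mul n 0
    rw [← hj, h0, mul_comm h N]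
    exact fix_mul hfix h
  have pow_inj : ∀ n, Function.Injective
      fun x : AlgebraicClosure (ZMod p) => x ^ p ^ n := fun n =>
    iterateFrobenius_inj (AlgebraicClosure (ZMod p)) p n
  have α_fix : ∀ n, α n ^ p ^ (h * N) = α n := by
    intro n
    apply pow_inj (h * n)
    simpa only [hβdef, pow_right_comm] using β_fix n
  refine ⟨k * N, Nat.mul_pos hk hN, fun n => pow_inj (h * n) ?_⟩
  have hT : β (n + N * k) = β n := by simpa using hper.nat_mul N n
  have hexp : h * (n + N * k) = h * N * k + h * n := by ring
  simp only [hβdef, hexp] at hT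
  rwa [pow_add, pow_mul, fix_mul (α_fix _), mul_comm N k] at hT
end
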